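/- arXiv:2111.07829 — 6 statements merged into one kernel-verified Lean document; each statement's English description precedes it below -/
import Mathlib

section
/- Let n ≥ 1, let C ⊆ ℝⁿ be a nonempty closed proper convex cone, let K ⊆ ℝⁿ be a compact set, and let ξ be a point of the topological interior of the dual cone C*. Then: (i) for all real numbers a ≤ b, the set {x ∈ K + C : a ≤ ⟨ξ, x⟩ ≤ b} is compact (i.e. the linear form ⟨ξ, ·⟩ is proper on the Minkowski sum K + C); and (ii) there exists a ∈ ℝ such that ⟨ξ, x⟩ ≥ a for every x ∈ K + C. -/
open MeasureTheory Filter Set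
open scoped RealInnerProductSpace Topology Pointwise

noncomputable section

/-- A point in the interior of the dual cone dominates a positive multiple of the norm. -/
theorem exists_pos_mul_norm_le_inner_of_mem_interior_dual
    {E : Type*} [NormedAddCommGroup E] [InnerProductSpace ℝ E] {C : Set E} {ξ : E}
    (hξ : ξ ∈ interior {y : E | ∀ x ∈ C, 0 ≤ ⟪y, x⟫}) :
    ∃ ε : ℝ, 0 < ε ∧ ∀ x ∈ C, ε * ‖x‖ ≤ ⟪ξ, x⟫ := by
  obtain ⟨ε, hε, hball⟩ := Metric.nhds_basis_closedBall.mem_iff.1 (mem_interior_iff_mem_nhds.1 hξ)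
  refine ⟨ε, hε, fun x hx => ?_⟩
  rcases eq_or_ne x 0 with rfl | hx0
  · simp
  have hnorm : ‖x‖ ≠ 0 := norm_ne_zero_iff.2 hx0
  have hmem : ξ - (ε / ‖x‖) • x ∈ Metric.closedBall ξ ε := by
    rw [mem_closedBall_iff_norm, sub_sub_cancel_left, norm_neg, norm_smul, norm_div, norm_norm,
      div_mul_cancel₀ _ hnorm, Real.norm_of_nonneg hε.le]
  have h : 0 ≤ ⟪ξ - (ε / ‖x‖) • x, x⟫ := hball hmem x hx
  rw [inner_sub_left, real_inner_smul_left, real_inner_self_eq_norm_sq] at h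
  have heq : ε / ‖x‖ * ‖x‖ ^ 2 = ε * ‖x‖ := by field_simp
  linarith

/-- properness of ξ on K + C and lower-boundedness, for ξ in the
interior of the dual cone of a nonempty closed proper convex cone C. -/
theorem xi_proper_on_supp
    (n : ℕ) (hn : 1 ≤ n)
    (C K : Set (EuclideanSpace ℝ (Fin n)))
    (hCne : C.Nonempty) (hCclosed : IsClosed C)
    (hCcone : ∀ t : ℝ, 0 < t → ∀ x ∈ C, t • x ∈ C)
    (hCconvex : Convex ℝ C)
    (hCproper : C ∩ (-C) = {0})
    (hK : IsCompact K)
    (ξ : EuclideanSpace ℝ (Fin n))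
    (hξ : ξ ∈ interior {y : EuclideanSpace ℝ (Fin n) | ∀ x ∈ C, 0 ≤ ⟪y, x⟫}) :
    (∀ a b : ℝ, a ≤ b →
      IsCompact {x ∈ K + C | a ≤ ⟪ξ, x⟫ ∧ ⟪ξ, x⟫ ≤ b}) ∧
    (∃ a : ℝ, ∀ x ∈ K + C, a ≤ ⟪ξ, x⟫) := by
  obtain ⟨ε, hε, hC⟩ := exists_pos_mul_norm_le_inner_of_mem_interior_dual hξ
  obtain ⟨M, hM⟩ := hK.isBounded.exists_norm_le
  have hlower : ∀ k ∈ K, -(‖ξ‖ * M) ≤ ⟪ξ, k⟫ := fun k hk =>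
    (neg_le_neg (mul_le_mul_of_nonneg_left (hM k hk) (norm_nonneg ξ))).trans
      (abs_le.1 (abs_real_inner_le_norm ξ k)).1
  constructor
  · intro a b _
    refine Metric.isCompact_of_isClosed_isBounded ?_ ?_
    · have hcont : Continuous fun x : EuclideanSpace ℝ (Fin n) => ⟪ξ, x⟫ := by fun_prop
      exact (hCclosed.add_left_of_isCompact hK).inter (isClosed_Icc.preimage hcont)
    · refine isBounded_iff_forall_norm_le.2 ⟨M + (b + ‖ξ‖ * M) / ε, ?_⟩
      rintro _ ⟨⟨k, hk, c, hc, rfl⟩, -, hb⟩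
      refine (norm_add_le k c).trans (add_le_add (hM k hk) ((le_div_iff₀' hε).2 ?_))
      rw [inner_add_right] at hb
      linarith [hC c hc, hlower k hk]
  · refine ⟨-(‖ξ‖ * M), ?_⟩
    rintro _ ⟨k, hk, c, hc, rfl⟩
    rw [inner_add_right]
    linarith [hC c hc, hlower k hk, mul_nonneg hε.le (norm_nonneg c)]
end
end

section
/- Let n ≥ 1, let C ⊆ ℝⁿ be a nonempty closed convex set, and let ξ ∈ ℝⁿ be such that the linear form ⟨ξ, ·⟩ is proper on C, meaning that {x ∈ C : a ≤ ⟨ξ, x⟩ ≤ b} is compact for all real numbers a ≤ b. Then the image {⟨ξ, x⟩ : x ∈ C} ⊆ ℝ equals the interval {t ∈ ℝ : −h_C(−ξ) ≤ t ≤ h_C(ξ)} (an inequality against +∞ being vacuous), and for every t in this interval the fiber {x ∈ C : ⟨ξ, x⟩ = t} is nonempty, compact and convex. -/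
open MeasureTheory Filter Set
open scoped RealInnerProductSpace Topology Pointwise

noncomputable section

/-- The support function of a set `A ⊆ ℝⁿ`, with values in `ℝ ∪ {±∞}`:
`h_A(ξ) = sup_{x ∈ A} ⟪ξ, x⟫`. -/
def suppFn {n : ℕ} (A : Set (EuclideanSpace ℝ (Fin n)))
    (ξ : EuclideanSpace ℝ (Fin n)) : EReal :=
  ⨆ x ∈ A, ((⟪ξ, x⟫ : ℝ) : EReal)

/-- A linear form that is proper on a nonempty set `C` attains its supremum on `C` if that
supremum is finite; hence every real number below the supremum is below some value. -/
theorem exists_le_inner_of_le_suppFn {n : ℕ} {C : Set (EuclideanSpace ℝ (Fin n))}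
    (hCne : C.Nonempty) {ξ : EuclideanSpace ℝ (Fin n)}
    (hproper : ∀ a b : ℝ, a ≤ b → IsCompact {x ∈ C | a ≤ ⟪ξ, x⟫ ∧ ⟪ξ, x⟫ ≤ b})
    {t : ℝ} (ht : (t : EReal) ≤ suppFn C ξ) : ∃ x ∈ C, t ≤ ⟪ξ, x⟫ := by
  by_contra! hlt
  obtain ⟨x₀, hx₀⟩ := hCne
  obtain ⟨y, ⟨hyC, hy, -⟩, hmax⟩ := (hproper ⟪ξ, x₀⟫ t (hlt x₀ hx₀).le).exists_isMaxOn
    ⟨x₀, hx₀, le_rfl, (hlt x₀ hx₀).le⟩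
    (show ContinuousOn (fun x => (⟪ξ, x⟫ : ℝ)) _ by fun_prop)
  have hsup : suppFn C ξ ≤ ((⟪ξ, y⟫ : ℝ) : EReal) := by
    refine iSup₂_le fun x hx => EReal.coe_le_coe_iff.2 ?_
    rcases le_total (⟪ξ, x₀⟫ : ℝ) ⟪ξ, x⟫ with h | h
    · exact hmax ⟨hx, h, (hlt x hx).le⟩
    · exact h.trans hy
  exact (hlt y hyC).not_ge (EReal.coe_le_coe_iff.1 (ht.trans hsup))

theorem inner_le_suppFn {n : ℕ} {C : Set (EuclideanSpace ℝ (Fin n))}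
    (ξ : EuclideanSpace ℝ (Fin n)) {x : EuclideanSpace ℝ (Fin n)} (hx : x ∈ C) :
    ((⟪ξ, x⟫ : ℝ) : EReal) ≤ suppFn C ξ :=
  le_iSup₂_of_le x hx le_rfl

/-- if the linear form `⟪ξ, ·⟫` is proper on a nonempty closed convex
set `C`, then its image on `C` is exactly the interval `[-h_C(-ξ), h_C(ξ)]` (intersected
with `ℝ`), and every fiber over this interval is nonempty, compact and convex. -/
theorem image_of_proper_linear_form_on_closed_convex
    (n : ℕ) (hn : 1 ≤ n)
    (C : Set (EuclideanSpace ℝ (Fin n)))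
    (hCne : C.Nonempty) (hCclosed : IsClosed C) (hCconvex : Convex ℝ C)
    (ξ : EuclideanSpace ℝ (Fin n))
    (hproper : ∀ a b : ℝ, a ≤ b →
      IsCompact {x ∈ C | a ≤ ⟪ξ, x⟫ ∧ ⟪ξ, x⟫ ≤ b}) :
    ((fun x => (⟪ξ, x⟫ : ℝ)) '' C
      = {t : ℝ | -suppFn C (-ξ) ≤ (t : EReal) ∧ (t : EReal) ≤ suppFn C ξ}) ∧
    (∀ t : ℝ, -suppFn C (-ξ) ≤ (t : EReal) → (t : EReal) ≤ suppFn C ξ →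
      ({x ∈ C | ⟪ξ, x⟫ = t}).Nonempty ∧
      IsCompact {x ∈ C | ⟪ξ, x⟫ = t} ∧
      Convex ℝ {x ∈ C | ⟪ξ, x⟫ = t}) := by
  have hproper_neg : ∀ a b : ℝ, a ≤ b → IsCompact {x ∈ C | a ≤ ⟪-ξ, x⟫ ∧ ⟪-ξ, x⟫ ≤ b} := by
    intro a b hab
    convert hproper (-b) (-a) (neg_le_neg hab) using 4 with x
    rw [inner_neg_left, le_neg, neg_le, and_comm]
  have hfiber : ∀ t : ℝ, -suppFn C (-ξ) ≤ (t : EReal) → (t : EReal) ≤ suppFn C ξ →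
      ∃ x ∈ C, ⟪ξ, x⟫ = t := by
    intro t hlo hhi
    obtain ⟨x, hx, htx⟩ := exists_le_inner_of_le_suppFn hCne hproper hhi
    obtain ⟨y, hy, hty⟩ := exists_le_inner_of_le_suppFn (t := -t) hCne hproper_neg
      (by rw [EReal.coe_neg]; exact EReal.neg_le.1 hlo)
    rw [inner_neg_left, neg_le_neg_iff] at hty
    exact hCconvex.isPreconnected.intermediate_value hy hx
      (show ContinuousOn (fun x => (⟪ξ, x⟫ : ℝ)) C by fun_prop) ⟨hty, htx⟩
  refine ⟨Subset.antisymm ?_ fun t ht => hfiber t ht.1 ht.2, fun t hlo hhi => ⟨?_, ?_, ?_⟩⟩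
  · rintro _ ⟨x, hx, rfl⟩
    refine ⟨EReal.neg_le.2 ?_, inner_le_suppFn ξ hx⟩
    simpa only [inner_neg_left, EReal.coe_neg] using inner_le_suppFn (-ξ) hx
  · exact hfiber t hlo hhi
  · convert hproper t t le_rfl using 4 with x
    rw [le_antisymm_iff, and_comm]
  · exact hCconvex.inter (convex_hyperplane (innerₛₗ ℝ ξ).isLinear t)
end
end

section
/- Let d ≥ 1, let κ : ℝ → ℂ be locally integrable, let n ≥ 1, and for each i = 1, …, n let m_i ∈ ℤ and let P_i ⊆ ℝ^d be a nonempty compact convex polytope (the convex hull of a finite set). Define T : ℝ^d → ℂ by T(ξ) = Σ_{i=1}^n m_i · ∫_ℝ κ(t) · 1_{[min_{x∈P_i} ⟨ξ,x⟩, max_{x∈P_i} ⟨ξ,x⟩]}(t) dt. Then T is well-defined (each integrand is integrable) and T is continuous on all of ℝ^d. -/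
open MeasureTheory Filter Set
open scoped RealInnerProductSpace Topology Pointwise

noncomputable section

theorem MeasureTheory.LocallyIntegrable.continuous_integral_indicator_Icc
    {E X : Type*} [NormedAddCommGroup E] [NormedSpace ℝ E] [TopologicalSpace X] {κ : ℝ → E}
    (hκ : LocallyIntegrable κ volume) {a b : X → ℝ} (ha : Continuous a) (hb : Continuous b)
    (hab : ∀ x, a x ≤ b x) :
    Continuous fun x => ∫ t, (Set.Icc (a x) (b x)).indicator κ t := by
  have hint : ∀ u v : ℝ, IntervalIntegrable κ volume u v := fun u v =>
    (hκ.integrableOn_isCompact isCompact_uIcc).intervalIntegrable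
  have hprim : Continuous fun u => ∫ t in (0 : ℝ)..u, κ t :=
    intervalIntegral.continuous_primitive hint 0
  refine ((hprim.comp hb).sub (hprim.comp ha)).congr fun x => ?_
  rw [integral_indicator measurableSet_Icc, integral_Icc_eq_integral_Ioc,
    ← intervalIntegral.integral_of_le (hab x)]
  exact intervalIntegral.integral_interval_sub_left (hint _ _) (hint _ _)

/-- the hybrid transform with locally integrable kernel `κ` of a compactly
supported PL-constructible function `Σ mᵢ 1_{Pᵢ}` (each `Pᵢ` a nonempty compact convex
polytope) is well-defined and continuous on all of `ℝ^d`. -/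
theorem hybrid_transform_continuous_of_compact_polytopes
    (d : ℕ) (hd : 1 ≤ d)
    (κ : ℝ → ℂ) (hκ : LocallyIntegrable κ volume)
    (n : ℕ) (hn : 1 ≤ n)
    (m : Fin n → ℤ)
    (F : Fin n → Finset (EuclideanSpace ℝ (Fin d)))
    (hF : ∀ i, (F i).Nonempty) :
    (∀ (i : Fin n) (ξ : EuclideanSpace ℝ (Fin d)),
      Integrable
        (fun t => (Set.Icc
            (sInf ((fun x => (⟪ξ, x⟫ : ℝ)) '' convexHull ℝ (↑(F i) : Set (EuclideanSpace ℝ (Fin d)))))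
            (sSup ((fun x => (⟪ξ, x⟫ : ℝ)) '' convexHull ℝ (↑(F i) : Set (EuclideanSpace ℝ (Fin d)))))).indicator κ t)
        volume) ∧
    Continuous (fun ξ : EuclideanSpace ℝ (Fin d) =>
      ∑ i : Fin n, (m i : ℂ) *
        ∫ t, (Set.Icc
            (sInf ((fun x => (⟪ξ, x⟫ : ℝ)) '' convexHull ℝ (↑(F i) : Set (EuclideanSpace ℝ (Fin d)))))
            (sSup ((fun x => (⟪ξ, x⟫ : ℝ)) '' convexHull ℝ (↑(F i) : Set (EuclideanSpace ℝ (Fin d)))))).indicator κ t) := by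
  have hcpt : ∀ i, IsCompact (convexHull ℝ (↑(F i) : Set (EuclideanSpace ℝ (Fin d)))) :=
    fun i => (F i).finite_toSet.isCompact_convexHull ℝ
  have hcont : Continuous (Function.uncurry fun ξ x : EuclideanSpace ℝ (Fin d) => (⟪ξ, x⟫ : ℝ)) :=
    continuous_inner
  refine ⟨fun i ξ => (integrable_indicator_iff measurableSet_Icc).mpr
    (hκ.integrableOn_isCompact isCompact_Icc), ?_⟩
  refine continuous_finsetSum _ fun i _ => continuous_const.mul ?_
  refine hκ.continuous_integral_indicator_Icc ((hcpt i).continuous_sInf hcont)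
    ((hcpt i).continuous_sSup hcont) fun ξ => ?_
  have himg : IsCompact ((fun x => (⟪ξ, x⟫ : ℝ)) ''
      convexHull ℝ (↑(F i) : Set (EuclideanSpace ℝ (Fin d)))) :=
    (hcpt i).image (by fun_prop)
  exact Real.sInf_le_sSup _ himg.bddBelow himg.bddAbove
end
end

section
/- Let d ≥ 1, let F ⊆ ℝ^d be a finite nonempty set, and let P = conv(F) be its convex hull. Then there exist finitely many open convex polyhedral cones Γ_1, …, Γ_m ⊆ ℝ^d and points v_1, …, v_m ∈ F such that ℝ^d = ⋃_{j=1}^m closure(Γ_j) and, for every j and every ξ ∈ Γ_j, max_{x ∈ P} ⟨ξ, x⟩ = ⟨ξ, v_j⟩ (equivalently, ⟨ξ, v_j⟩ ≥ ⟨ξ, w⟩ for all w ∈ F). In particular the support function h_P is linear on each Γ_j. -/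
open MeasureTheory Filter Set
open scoped RealInnerProductSpace Topology Pointwise

noncomputable section

/-- An open convex polyhedral cone in `ℝ^d`: an intersection of finitely many open
half-spaces `{x | ⟪u, x⟫ > 0}` with `u ≠ 0` (the empty intersection being `ℝ^d`). -/
def IsOpenPolyhedralCone {d : ℕ} (Γ : Set (EuclideanSpace ℝ (Fin d))) : Prop :=
  ∃ s : Finset (EuclideanSpace ℝ (Fin d)),
    (0 : EuclideanSpace ℝ (Fin d)) ∉ s ∧
    Γ = ⋂ u ∈ s, {x : EuclideanSpace ℝ (Fin d) | 0 < ⟪u, x⟫}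

/-- The complement of the hyperplane orthogonal to a nonzero vector is dense. -/
lemma dense_setOf_inner_ne_zero {E : Type*} [NormedAddCommGroup E] [InnerProductSpace ℝ E]
    {u : E} (hu : u ≠ 0) : Dense {x : E | ⟪u, x⟫ ≠ 0} := by
  have h : LinearMap.ker (innerSL ℝ u).toLinearMap ≠ ⊤ := fun h => hu <| by
    have hmem : u ∈ LinearMap.ker (innerSL ℝ u).toLinearMap := h ▸ Submodule.mem_top
    simpa using hmem
  have hcompl : {x : E | ⟪u, x⟫ ≠ 0} = (LinearMap.ker (innerSL ℝ u).toLinearMap : Set E)ᶜ := by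
    ext x
    simp
  rw [hcompl, ← interior_eq_empty_iff_dense_compl]
  by_contra hne
  exact h (Submodule.eq_top_of_nonempty_interior' _ (nonempty_iff_ne_empty.2 hne))

lemma isOpen_setOf_inner_ne_zero {E : Type*} [NormedAddCommGroup E] [InnerProductSpace ℝ E]
    (u : E) : IsOpen {x : E | ⟪u, x⟫ ≠ 0} :=
  isOpen_ne_fun (by fun_prop) continuous_const

/-- Generic linear functionals take pairwise distinct values on a finite set. -/
lemma dense_setOf_injOn_inner {E : Type*} [NormedAddCommGroup E] [InnerProductSpace ℝ E]
    (F : Finset E) : Dense {ξ : E | InjOn (fun x => (⟪ξ, x⟫ : ℝ)) F} := by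
  classical
  have key : ∀ s : Finset E, 0 ∉ s → Dense (⋂ u ∈ s, {x : E | ⟪u, x⟫ ≠ 0}) := by
    intro s
    induction s using Finset.induction_on with
    | empty => simp
    | insert a s _ ih =>
      intro h0
      rw [Finset.mem_insert, not_or] at h0
      rw [Finset.set_biInter_insert]
      exact (dense_setOf_inner_ne_zero (Ne.symm h0.1)).inter_of_isOpen_left (ih h0.2)
        (isOpen_setOf_inner_ne_zero a)
  refine (key (((F ×ˢ F).image fun p => p.1 - p.2).erase 0) (by simp)).mono ?_
  intro ξ hξ x hx y hy hxy
  by_contra hne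
  refine mem_iInter₂.1 hξ (x - y) (Finset.mem_erase.2 ⟨sub_ne_zero.2 hne,
    Finset.mem_image.2 ⟨(x, y), Finset.mk_mem_product hx hy, rfl⟩⟩) ?_
  rw [real_inner_comm, inner_sub_right]
  exact sub_eq_zero.2 hxy

/-- The functionals whose maximum over `F` is attained at `v` only. -/
def openNormalCone {d : ℕ} (F : Finset (EuclideanSpace ℝ (Fin d)))
    (v : EuclideanSpace ℝ (Fin d)) : Set (EuclideanSpace ℝ (Fin d)) :=
  {ξ | ∀ w ∈ F, w ≠ v → ⟪ξ, w⟫ < ⟪ξ, v⟫}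

lemma isOpenPolyhedralCone_openNormalCone {d : ℕ} (F : Finset (EuclideanSpace ℝ (Fin d)))
    (v : EuclideanSpace ℝ (Fin d)) : IsOpenPolyhedralCone (openNormalCone F v) := by
  classical
  refine ⟨(F.image fun w => v - w).erase 0, by simp, ?_⟩
  ext ξ
  have key : ∀ w, 0 < ⟪v - w, ξ⟫ ↔ ⟪ξ, w⟫ < ⟪ξ, v⟫ := fun w => by
    rw [real_inner_comm, inner_sub_right, sub_pos]
  simp only [openNormalCone, mem_ofPred_eq, mem_iInter, Finset.mem_erase, Finset.mem_image]
  constructor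
  · rintro h _ ⟨hne, w, hw, rfl⟩
    exact (key w).2 (h w hw fun hwv => hne (sub_eq_zero.2 hwv.symm))
  · intro h w hw hne
    exact (key w).1 (h _ ⟨sub_ne_zero.2 hne.symm, w, hw, rfl⟩)

lemma iUnion_closure_openNormalCone {d : ℕ} {F : Finset (EuclideanSpace ℝ (Fin d))}
    (hF : F.Nonempty) : ⋃ v : F, closure (openNormalCone F v) = univ := by
  rw [← closure_iUnion_of_finite, ← dense_iff_closure_eq]
  refine (dense_setOf_injOn_inner F).mono fun ξ hξ => ?_
  obtain ⟨v, hv, hmax⟩ := F.exists_max_image (fun x => (⟪ξ, x⟫ : ℝ)) hF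
  exact mem_iUnion.2 ⟨⟨v, hv⟩, fun w hw hne =>
    (hmax w hw).lt_of_ne fun h => hne (hξ hw hv h)⟩

/-- A linear functional attains its maximum over a convex hull where it does over the
generating set. -/
lemma isMaxOn_inner_convexHull {E : Type*} [NormedAddCommGroup E] [InnerProductSpace ℝ E]
    {s : Set E} {ξ v : E} (h : IsMaxOn (fun x => (⟪ξ, x⟫ : ℝ)) s v) :
    IsMaxOn (fun x => (⟪ξ, x⟫ : ℝ)) (convexHull ℝ s) v :=
  convexHull_min h (convex_halfSpace_le (innerSL ℝ ξ).toLinearMap.isLinear ⟪ξ, v⟫)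

/-- the support function of a polytope `P = conv(F)` is piecewise linear:
there are finitely many open convex polyhedral cones `Γⱼ` whose closures cover `ℝ^d`
and vertices `vⱼ ∈ F` such that on `Γⱼ` the maximum of `⟪ξ, ·⟫` over `P` is attained
at `vⱼ`, i.e. `h_P(ξ) = ⟪ξ, vⱼ⟫` there. -/
theorem support_function_piecewise_linear_on_fan
    (d : ℕ) (hd : 1 ≤ d)
    (F : Finset (EuclideanSpace ℝ (Fin d))) (hF : F.Nonempty) :
    ∃ (M : ℕ) (Γ : Fin M → Set (EuclideanSpace ℝ (Fin d)))
      (v : Fin M → EuclideanSpace ℝ (Fin d)),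
      (∀ j, IsOpenPolyhedralCone (Γ j)) ∧
      (∀ j, v j ∈ F) ∧
      (⋃ j, closure (Γ j)) = Set.univ ∧
      (∀ j, ∀ ξ ∈ Γ j,
        (∀ w ∈ F, ⟪ξ, w⟫ ≤ ⟪ξ, v j⟫) ∧
        IsMaxOn (fun x => (⟪ξ, x⟫ : ℝ))
          (convexHull ℝ (↑F : Set (EuclideanSpace ℝ (Fin d)))) (v j)) := by
  refine ⟨F.card, fun j => openNormalCone F (F.equivFin.symm j), fun j => F.equivFin.symm j,
    fun j => isOpenPolyhedralCone_openNormalCone F _, fun j => (F.equivFin.symm j).2, ?_, ?_⟩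
  · rw [← iUnion_closure_openNormalCone hF]
    exact F.equivFin.symm.surjective.iUnion_comp fun v : F => closure (openNormalCone F v)
  · intro j ξ hξ
    have hmax : ∀ w ∈ F, ⟪ξ, w⟫ ≤ ⟪ξ, (F.equivFin.symm j : EuclideanSpace ℝ (Fin d))⟫ := by
      intro w hw
      rcases eq_or_ne w (F.equivFin.symm j) with h | h
      · rw [← h]
      · exact (hξ w hw h).le
    exact ⟨hmax, isMaxOn_inner_convexHull hmax⟩
end
end

section
/- Let d ≥ 1, let p ∈ ℕ, let κ : ℝ → ℂ be of class C^p, let n ≥ 1, and for each i = 1, …, n let m_i ∈ ℤ and let P_i ⊆ ℝ^d be a nonempty compact convex polytope (the convex hull of a finite set). Define T : ℝ^d → ℂ by T(ξ) = Σ_{i=1}^n m_i · ∫_ℝ κ(t) · 1_{[min_{x∈P_i} ⟨ξ,x⟩, max_{x∈P_i} ⟨ξ,x⟩]}(t) dt. Then there exists a finite family Γ_1, …, Γ_m of open convex polyhedral cones of ℝ^d such that ℝ^d = ⋃_{j=1}^m closure(Γ_j) and, for each j, the restriction of T to Γ_j is of class C^{p+1}. -/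
open MeasureTheory Filter Set
open scoped RealInnerProductSpace Topology Pointwise

noncomputable section

/-- In a real inner product space, finitely many hyperplanes through the origin have a dense
complement. -/
theorem dense_setOf_forall_inner_ne_zero {E : Type*} [NormedAddCommGroup E]
    [InnerProductSpace ℝ E] (D : Finset E) (hD : (0 : E) ∉ D) :
    Dense {x : E | ∀ u ∈ D, ⟪u, x⟫ ≠ 0} := by
  have hopen : ∀ u : E, IsOpen {x : E | ⟪u, x⟫ ≠ 0} := fun u =>
    isOpen_ne_fun (by fun_prop) continuous_const
  have hdense : ∀ u : E, u ≠ 0 → Dense {x : E | ⟪u, x⟫ ≠ 0} := by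
    intro u hu
    have hker : (innerSL ℝ u).toLinearMap.ker ≠ ⊤ := fun h =>
      hu (inner_self_eq_zero.mp (LinearMap.mem_ker.mp (h ▸ Submodule.mem_top : u ∈ _)))
    have hint : interior ((innerSL ℝ u).toLinearMap.ker : Set E) = ∅ := by
      by_contra h
      exact hker (Submodule.eq_top_of_nonempty_interior' _ (nonempty_iff_ne_empty.mpr h))
    exact interior_eq_empty_iff_dense_compl.mp hint
  classical
  induction D using Finset.induction_on with
  | empty => simp
  | insert u D _ ih =>
    rw [Finset.mem_insert, not_or] at hD
    simp only [Finset.forall_mem_insert, ofPred_and]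
    exact (hdense u (Ne.symm hD.1)).inter_of_isOpen_left (ih hD.2) (hopen u)

/-- If every difference of distinct points of `A` lies, up to sign, in `s`, then a single point
of `A` maximizes `⟪ξ, ·⟫` on `A` for all `ξ` in the cone cut out by `s`. -/
theorem exists_forall_inner_le_of_cone {E : Type*} [NormedAddCommGroup E]
    [InnerProductSpace ℝ E] {A : Finset E} (hA : A.Nonempty) {s : Set E}
    (hs : ∀ x ∈ A, ∀ y ∈ A, x ≠ y → x - y ∈ s ∨ y - x ∈ s)
    (hne : (⋂ u ∈ s, {x : E | 0 < ⟪u, x⟫}).Nonempty) :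
    ∃ a ∈ A, ∀ ξ ∈ ⋂ u ∈ s, {x : E | 0 < ⟪u, x⟫}, ∀ y ∈ A, ⟪ξ, y⟫ ≤ ⟪ξ, a⟫ := by
  obtain ⟨ξ₀, h₀⟩ := hne
  obtain ⟨a, ha, hmax⟩ := A.exists_max_image (fun x => (⟪ξ₀, x⟫ : ℝ)) hA
  refine ⟨a, ha, fun ξ hξ y hy => ?_⟩
  simp only [mem_iInter, mem_ofPred_eq, real_inner_comm] at h₀ hξ
  rcases eq_or_ne a y with rfl | hay
  · exact le_rfl
  rcases hs a ha y hy hay with h | h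
  · have := hξ _ h
    rw [inner_sub_right] at this
    linarith
  · have := h₀ _ h
    rw [inner_sub_right] at this
    linarith [hmax y hy]

/-- The maximum of a linear functional over a convex hull is attained at a generating point. -/
theorem isGreatest_inner_image_convexHull {E : Type*} [NormedAddCommGroup E]
    [InnerProductSpace ℝ E] {A : Set E} {a ξ : E} (ha : a ∈ A)
    (h : ∀ y ∈ A, ⟪ξ, y⟫ ≤ ⟪ξ, a⟫) :
    IsGreatest ((fun x => (⟪ξ, x⟫ : ℝ)) '' convexHull ℝ A) ⟪ξ, a⟫ := by
  refine ⟨mem_image_of_mem _ (subset_convexHull ℝ A ha), ?_⟩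
  rintro _ ⟨x, hx, rfl⟩
  exact convexHull_min h (convex_halfSpace_le (innerSL ℝ ξ).toLinearMap.isLinear _) hx

/-- The minimum of a linear functional over a convex hull is attained at a generating point. -/
theorem isLeast_inner_image_convexHull {E : Type*} [NormedAddCommGroup E]
    [InnerProductSpace ℝ E] {A : Set E} {b ξ : E} (hb : b ∈ A)
    (h : ∀ y ∈ A, ⟪ξ, b⟫ ≤ ⟪ξ, y⟫) :
    IsLeast ((fun x => (⟪ξ, x⟫ : ℝ)) '' convexHull ℝ A) ⟪ξ, b⟫ := by
  refine ⟨mem_image_of_mem _ (subset_convexHull ℝ A hb), ?_⟩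
  rintro _ ⟨x, hx, rfl⟩
  exact convexHull_min h (convex_halfSpace_ge (innerSL ℝ ξ).toLinearMap.isLinear _) hx

/-- A primitive of a `C^p` function is `C^{p+1}`. -/
theorem contDiff_integral_of_contDiff {E : Type*} [NormedAddCommGroup E] [NormedSpace ℝ E]
    [CompleteSpace E] {p : ℕ} {f : ℝ → E} (hf : ContDiff ℝ p f) (a : ℝ) :
    ContDiff ℝ (p + 1) (fun x => ∫ t in a..x, f t) := by
  have hderiv : ∀ x, HasDerivAt (fun x => ∫ t in a..x, f t) (f x) x := fun x =>
    hf.continuous.integral_hasStrictDerivAt a x |>.hasDerivAt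
  refine contDiff_succ_iff_deriv.mpr ⟨fun x => (hderiv x).differentiableAt, by simp, ?_⟩
  rwa [funext fun x => (hderiv x).deriv]

/-- On a cone which decides the sign of `⟪x - y, ·⟫` for all distinct `x, y ∈ A`, integrating a
`C^p` kernel over the range of `⟪ξ, ·⟫` on the convex hull of `A` is `C^{p+1}` in `ξ`. -/
theorem contDiffOn_integral_indicator_convexHull {E : Type*} [NormedAddCommGroup E]
    [InnerProductSpace ℝ E] {p : ℕ} {κ : ℝ → ℂ} (hκ : ContDiff ℝ p κ)
    {A : Finset E} (hA : A.Nonempty) {s : Set E}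
    (hs : ∀ x ∈ A, ∀ y ∈ A, x ≠ y → x - y ∈ s ∨ y - x ∈ s) :
    ContDiffOn ℝ (p + 1) (fun ξ : E =>
        ∫ t, (Set.Icc (sInf ((fun x => (⟪ξ, x⟫ : ℝ)) '' convexHull ℝ (↑A : Set E)))
          (sSup ((fun x => (⟪ξ, x⟫ : ℝ)) '' convexHull ℝ (↑A : Set E)))).indicator κ t)
      (⋂ u ∈ s, {x : E | 0 < ⟪u, x⟫}) := by
  rcases (⋂ u ∈ s, {x : E | 0 < ⟪u, x⟫}).eq_empty_or_nonempty with hempty | hne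
  · rw [hempty]
    exact contDiffOn_empty
  obtain ⟨a, ha, hmax⟩ := exists_forall_inner_le_of_cone hA hs hne
  obtain ⟨b, hb, hmin⟩ : ∃ b ∈ A, ∀ ξ ∈ ⋂ u ∈ s, {x : E | 0 < ⟪u, x⟫},
      ∀ y ∈ A, ⟪ξ, b⟫ ≤ ⟪ξ, y⟫ := by
    classical
    obtain ⟨c, hc, hcmax⟩ := exists_forall_inner_le_of_cone (A := A.image Neg.neg)
      (hA.image _) (s := s) (by
        simp only [Finset.forall_mem_image]
        intro x hx y hy hxy
        rw [neg_sub_neg, neg_sub_neg]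
        exact hs y hy x hx (fun h => hxy (by rw [h]))) hne
    obtain ⟨b, hb, rfl⟩ := Finset.mem_image.mp hc
    refine ⟨b, hb, fun ξ hξ y hy => ?_⟩
    have := hcmax ξ hξ (-y) (Finset.mem_image_of_mem _ hy)
    rwa [inner_neg_right, inner_neg_right, neg_le_neg_iff] at this
  have hG := contDiff_integral_of_contDiff hκ 0
  have hinner : ∀ c : E, ContDiff ℝ (p + 1) (fun ξ : E => (⟪ξ, c⟫ : ℝ)) := fun c =>
    contDiff_id.inner ℝ contDiff_const
  refine ContDiffOn.congr
    ((hG.comp (hinner a)).sub (hG.comp (hinner b))).contDiffOn fun ξ hξ => ?_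
  rw [(isGreatest_inner_image_convexHull (Finset.mem_coe.mpr ha) (hmax ξ hξ)).csSup_eq,
    (isLeast_inner_image_convexHull (Finset.mem_coe.mpr hb) (hmin ξ hξ)).csInf_eq,
    integral_indicator measurableSet_Icc, integral_Icc_eq_integral_Ioc,
    ← intervalIntegral.integral_of_le (hmin ξ hξ a ha)]
  exact (intervalIntegral.integral_interval_sub_left
    (hκ.continuous.intervalIntegrable _ _) (hκ.continuous.intervalIntegrable _ _)).symm

/-- the hybrid transform with a `C^p` kernel of a compactly supported
PL-constructible function `Σ mᵢ 1_{Pᵢ}` (each `Pᵢ` a nonempty compact convex polytope)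
is `C^{p+1}` on each cone of a finite family of open convex polyhedral cones whose
closures cover `ℝ^d`. -/
theorem hybrid_transform_regularity_of_compact_polytopes
    (d : ℕ) (hd : 1 ≤ d) (p : ℕ)
    (κ : ℝ → ℂ) (hκ : ContDiff ℝ p κ)
    (n : ℕ) (hn : 1 ≤ n)
    (m : Fin n → ℤ)
    (F : Fin n → Finset (EuclideanSpace ℝ (Fin d)))
    (hF : ∀ i, (F i).Nonempty) :
    ∃ (M : ℕ) (Γ : Fin M → Set (EuclideanSpace ℝ (Fin d))),
      (∀ j, IsOpenPolyhedralCone (Γ j)) ∧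
      (⋃ j, closure (Γ j)) = Set.univ ∧
      (∀ j, ContDiffOn ℝ (p + 1)
        (fun ξ : EuclideanSpace ℝ (Fin d) =>
          ∑ i : Fin n, (m i : ℂ) *
            ∫ t, (Set.Icc
                (sInf ((fun x => (⟪ξ, x⟫ : ℝ)) '' convexHull ℝ (↑(F i) : Set (EuclideanSpace ℝ (Fin d)))))
                (sSup ((fun x => (⟪ξ, x⟫ : ℝ)) '' convexHull ℝ (↑(F i) : Set (EuclideanSpace ℝ (Fin d)))))).indicator κ t)
        (Γ j)) := by
  classical
  set A := Finset.univ.biUnion F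
  set D := ((A ×ˢ A).image fun z => z.1 - z.2).erase 0
  have hmem : ∀ x ∈ A, ∀ y ∈ A, x ≠ y → x - y ∈ D := fun x hx y hy hxy =>
    Finset.mem_erase.mpr ⟨sub_ne_zero.mpr hxy,
      Finset.mem_image.mpr ⟨(x, y), Finset.mk_mem_product hx hy, rfl⟩⟩
  have hD0 : (0 : EuclideanSpace ℝ (Fin d)) ∉ D := Finset.notMem_erase _ _
  set S := D.powerset.filter fun s =>
    ∀ x ∈ A, ∀ y ∈ A, x ≠ y → x - y ∈ s ∨ y - x ∈ s
  have hS : ∀ j, (S.equivFin.symm j : Finset (EuclideanSpace ℝ (Fin d))) ⊆ D ∧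
      ∀ x ∈ A, ∀ y ∈ A, x ≠ y → x - y ∈ (S.equivFin.symm j).1 ∨
        y - x ∈ (S.equivFin.symm j).1 := fun j =>
    (Finset.mem_filter.mp (S.equivFin.symm j).2).imp_left Finset.mem_powerset.mp
  refine ⟨S.card, fun j => ⋂ u ∈ (S.equivFin.symm j).1,
    {x : EuclideanSpace ℝ (Fin d) | 0 < ⟪u, x⟫},
    fun j => ⟨_, fun h => hD0 ((hS j).1 h), rfl⟩, ?_, fun j => ?_⟩
  · refine eq_univ_of_univ_subset ?_
    rw [← (dense_setOf_forall_inner_ne_zero D hD0).closure_eq]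
    refine closure_minimal (fun ξ hξ => ?_) (isClosed_iUnion_of_finite fun j => isClosed_closure)
    have hsS : (D.filter fun u => 0 < ⟪u, ξ⟫) ∈ S := by
      refine Finset.mem_filter.mpr ⟨Finset.mem_powerset.mpr (Finset.filter_subset _ _), ?_⟩
      intro x hx y hy hxy
      have hxyD := hmem x hx y hy hxy
      rcases (hξ _ hxyD).lt_or_gt with h | h
      · refine Or.inr (Finset.mem_filter.mpr ⟨hmem y hy x hx hxy.symm, ?_⟩)
        rw [← neg_sub, inner_neg_left]
        exact neg_pos.mpr h
      · exact Or.inl (Finset.mem_filter.mpr ⟨hxyD, h⟩)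
    refine mem_iUnion.mpr ⟨S.equivFin ⟨_, hsS⟩, subset_closure ?_⟩
    simp
  · refine ContDiffOn.sum fun i _ => contDiffOn_const.mul ?_
    exact contDiffOn_integral_indicator_convexHull hκ (hF i)
      (s := ((S.equivFin.symm j).1 : Set (EuclideanSpace ℝ (Fin d)))) fun x hx y hy =>
        (hS j).2 x (Finset.mem_biUnion.mpr ⟨i, Finset.mem_univ i, hx⟩)
          y (Finset.mem_biUnion.mpr ⟨i, Finset.mem_univ i, hy⟩)
end
end

section
/- Let I and J be finite index sets; for i ∈ I let m_i ∈ ℤ, a_i ∈ ℝ, b_i ∈ ℝ ∪ {+∞} with a_i ≤ b_i, and for j ∈ J let n_j ∈ ℤ, c_j ∈ ℝ, d_j ∈ ℝ ∪ {+∞} with c_j ≤ d_j. Write 1_{[x, y]} for the indicator of {t ∈ ℝ : x ≤ t ≤ y} when y ∈ ℝ and of [x, +∞) when y = +∞, and 1_{[x, +∞)} for the indicator of the closed right half-line. Define θ = Σ_{i∈I} m_i 1_{[a_i, b_i]}, θ' = Σ_{j∈J} n_j 1_{[c_j, d_j]}, τ = Σ_{(i,j)∈I×J} m_i n_j 1_{[a_i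 + c_j, b_i + d_j]} (with x + (+∞) = +∞), θ↑ = Σ_{i∈I} m_i 1_{[a_i, +∞)} and θ'↑ = Σ_{j∈J} n_j 1_{[c_j, +∞)}. For a function g of any of these forms set L(g) = ∫_ℝ e^{−t} g(t) dt (all these integrals converge absolutely). Then L(τ) = L(θ↑) · L(θ') + L(θ) · L(θ'↑) − L(θ) · L(θ'). -/
open MeasureTheory Filter Set
open scoped Topology Classical

noncomputable section

/-- `y ↦ e^{-y}` on the extended half-line, with `e^{-∞} = 0`. -/
def expNegTop : WithTop ℝ → ℝ
  | ⊤ => 0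
  | (y : ℝ) => Real.exp (-y)

@[simp] lemma expNegTop_top : expNegTop ⊤ = 0 := rfl

@[simp] lemma expNegTop_coe (y : ℝ) : expNegTop y = Real.exp (-y) := rfl

lemma expNegTop_add (x y : WithTop ℝ) : expNegTop (x + y) = expNegTop x * expNegTop y := by
  induction x with
  | top => simp
  | coe x =>
    induction y with
    | top => simp
    | coe y => rw [← WithTop.coe_add, expNegTop_coe, expNegTop_coe, expNegTop_coe, neg_add, Real.exp_add]

lemma integrable_and_integral_exp_neg_mul_interval (x : ℝ) (y : WithTop ℝ)
    (h : (x : WithTop ℝ) ≤ y) (r : ℝ) :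
    Integrable (fun t : ℝ => Real.exp (-t) * if x ≤ t ∧ (t : WithTop ℝ) ≤ y then r else 0) ∧
    ∫ t : ℝ, Real.exp (-t) * (if x ≤ t ∧ (t : WithTop ℝ) ≤ y then r else 0) =
      r * (Real.exp (-x) - expNegTop y) := by
  induction y with
  | top =>
    have e : (fun t : ℝ => Real.exp (-t) * if x ≤ t ∧ (t : WithTop ℝ) ≤ ⊤ then r else 0) =
        (Ici x).indicator (fun t => Real.exp (-t) * r) := by
      ext t
      simp [indicator_apply]
    rw [e]
    constructor
    · rw [integrable_indicator_iff measurableSet_Ici, integrableOn_Ici_iff_integrableOn_Ioi]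
      exact (integrableOn_exp_neg_Ioi x).mul_const r
    · rw [integral_indicator measurableSet_Ici, integral_Ici_eq_integral_Ioi,
        integral_mul_const, integral_exp_neg_Ioi]
      simp [mul_comm]
  | coe y =>
    have hxy : x ≤ y := WithTop.coe_le_coe.mp h
    have e : (fun t : ℝ => Real.exp (-t) * if x ≤ t ∧ (t : WithTop ℝ) ≤ y then r else 0) =
        (Icc x y).indicator (fun t => Real.exp (-t) * r) := by
      ext t
      simp [indicator_apply]
    rw [e]
    constructor
    · rw [integrable_indicator_iff measurableSet_Icc]
      exact Continuous.integrableOn_Icc (by fun_prop)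
    · rw [integral_indicator measurableSet_Icc, integral_Icc_eq_integral_Ioc,
        ← intervalIntegral.integral_of_le hxy, intervalIntegral.integral_mul_const,
        intervalIntegral.integral_comp_neg (fun t => Real.exp t), integral_exp]
      simp [mul_comm]

lemma integrable_and_integral_exp_neg_mul_sum_interval {ι : Type*} [Fintype ι]
    (r : ι → ℝ) (x : ι → ℝ) (y : ι → WithTop ℝ) (h : ∀ i, (x i : WithTop ℝ) ≤ y i) :
    Integrable (fun t : ℝ => Real.exp (-t) *
      ∑ i, if x i ≤ t ∧ (t : WithTop ℝ) ≤ y i then r i else 0) ∧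
    ∫ t : ℝ, Real.exp (-t) * (∑ i, if x i ≤ t ∧ (t : WithTop ℝ) ≤ y i then r i else 0) =
      ∑ i, r i * Real.exp (-x i) - ∑ i, r i * expNegTop (y i) := by
  have key i := integrable_and_integral_exp_neg_mul_interval (x i) (y i) (h i) (r i)
  simp only [Finset.mul_sum]
  refine ⟨integrable_finsetSum _ fun i _ => (key i).1, ?_⟩
  rw [integral_finsetSum _ fun i _ => (key i).1, ← Finset.sum_sub_distrib]
  exact Finset.sum_congr rfl fun i _ => by rw [(key i).2, mul_sub]

/-- the Euler–Laplace convolution identity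
`L(θ ⋆ θ') = L(θ ⋆ 1_{ℝ≥0})·L(θ') + L(θ)·L(θ' ⋆ 1_{ℝ≥0}) − L(θ)·L(θ')`
for finite integer combinations of indicators of closed (possibly unbounded above)
intervals, where `L(g) = ∫ e^{-t} g(t) dt`; all the integrals converge absolutely. -/
theorem euler_laplace_convolution_identity
    (nI nJ : ℕ)
    (m : Fin nI → ℤ) (a : Fin nI → ℝ) (b : Fin nI → WithTop ℝ)
    (hab : ∀ i, (a i : WithTop ℝ) ≤ b i)
    (N : Fin nJ → ℤ) (c : Fin nJ → ℝ) (d : Fin nJ → WithTop ℝ)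
    (hcd : ∀ j, (c j : WithTop ℝ) ≤ d j)
    (θ θ' τ θup θ'up : ℝ → ℝ)
    (hθ : ∀ t, θ t = ∑ i : Fin nI,
      if a i ≤ t ∧ (t : WithTop ℝ) ≤ b i then (m i : ℝ) else 0)
    (hθ' : ∀ t, θ' t = ∑ j : Fin nJ,
      if c j ≤ t ∧ (t : WithTop ℝ) ≤ d j then (N j : ℝ) else 0)
    (hτ : ∀ t, τ t = ∑ i : Fin nI, ∑ j : Fin nJ,
      if a i + c j ≤ t ∧ (t : WithTop ℝ) ≤ b i + d j then ((m i * N j : ℤ) : ℝ) else 0)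
    (hθup : ∀ t, θup t = ∑ i : Fin nI, if a i ≤ t then (m i : ℝ) else 0)
    (hθ'up : ∀ t, θ'up t = ∑ j : Fin nJ, if c j ≤ t then (N j : ℝ) else 0)
    (L : (ℝ → ℝ) → ℝ) (hL : ∀ g : ℝ → ℝ, L g = ∫ t : ℝ, Real.exp (-t) * g t) :
    Integrable (fun t => Real.exp (-t) * τ t) volume ∧
    Integrable (fun t => Real.exp (-t) * θ t) volume ∧
    Integrable (fun t => Real.exp (-t) * θ' t) volume ∧
    Integrable (fun t => Real.exp (-t) * θup t) volume ∧
    Integrable (fun t => Real.exp (-t) * θ'up t) volume ∧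
    L τ = L θup * L θ' + L θ * L θ'up - L θ * L θ' := by
  have Iθ := integrable_and_integral_exp_neg_mul_sum_interval (fun i => (m i : ℝ)) a b hab
  have Iθ' := integrable_and_integral_exp_neg_mul_sum_interval (fun j => (N j : ℝ)) c d hcd
  have Iθup := integrable_and_integral_exp_neg_mul_sum_interval (fun i => (m i : ℝ)) a
    (fun _ => ⊤) (fun _ => le_top)
  have Iθ'up := integrable_and_integral_exp_neg_mul_sum_interval (fun j => (N j : ℝ)) c
    (fun _ => ⊤) (fun _ => le_top)
  have Iτ := integrable_and_integral_exp_neg_mul_sum_interval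
    (fun p : Fin nI × Fin nJ => ((m p.1 * N p.2 : ℤ) : ℝ)) (fun p => a p.1 + c p.2)
    (fun p => b p.1 + d p.2)
    (fun p => by rw [WithTop.coe_add]; exact add_le_add (hab p.1) (hcd p.2))
  simp only [Fintype.sum_prod_type, ← hτ] at Iτ
  simp only [← hθ] at Iθ
  simp only [← hθ'] at Iθ'
  simp only [le_top, and_true, ← hθup, expNegTop_top, mul_zero, Finset.sum_const_zero,
    sub_zero] at Iθup
  simp only [le_top, and_true, ← hθ'up, expNegTop_top, mul_zero, Finset.sum_const_zero,
    sub_zero] at Iθ'up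
  refine ⟨Iτ.1, Iθ.1, Iθ'.1, Iθup.1, Iθ'up.1, ?_⟩
  have hlower : ∑ i, ∑ j, ((m i * N j : ℤ) : ℝ) * Real.exp (-(a i + c j)) =
      (∑ i, (m i : ℝ) * Real.exp (-a i)) * ∑ j, (N j : ℝ) * Real.exp (-c j) := by
    rw [Finset.sum_mul_sum]
    refine Finset.sum_congr rfl fun i _ => Finset.sum_congr rfl fun j _ => ?_
    rw [neg_add, Real.exp_add]
    push_cast
    ring
  have hupper : ∑ i, ∑ j, ((m i * N j : ℤ) : ℝ) * expNegTop (b i + d j) =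
      (∑ i, (m i : ℝ) * expNegTop (b i)) * ∑ j, (N j : ℝ) * expNegTop (d j) := by
    rw [Finset.sum_mul_sum]
    refine Finset.sum_congr rfl fun i _ => Finset.sum_congr rfl fun j _ => ?_
    rw [expNegTop_add]
    push_cast
    ring
  rw [hL, hL, hL, hL, hL, Iτ.2, Iθ.2, Iθ'.2, Iθup.2, Iθ'up.2, hlower, hupper]
  ring
end
end
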